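/- (Corollary 2.3, de Finetti reduction for mixed states with fixed marginal) Let n, dA, dB be positive natural numbers and let σ̂ be a positive semidefinite matrix indexed by Fin dA. Let ρ be a positive semidefinite, permutation-invariant matrix indexed by (Fin n → Fin dA × Fin dB) whose partial trace over the B-systems equals σ̂^⊗n. Then there exists a probability measure μ on the space of matrices indexed by Fin dA × Fin dB (Borel σ-algebra) such that: μ-almost every σ is positive semidefinite with partial trace over Fin dB equal to σ̂; every entry of σ ↦ σ^⊗n is μ-integrable; and g_{n, dA²·dB²} • T − ρ is positive semidefinite, where T is the matrix with entries T v w = ∫ (σ^⊗n) v w dμ(σ). -/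

import Mathlib

open MeasureTheory
open scoped ComplexOrder

noncomputable section

/-- `n`-fold tensor power of a matrix: entries `(σ^⊗n) v w = ∏ i, σ (v i) (w i)`. -/
def tensorPow {d : Type*} [Fintype d] (σ : Matrix d d ℂ) (n : ℕ) :
    Matrix (Fin n → d) (Fin n → d) ℂ :=
  Matrix.of fun v w => ∏ i, σ (v i) (w i)

/-- Partial trace over the second factor of a product index type. -/
def ptrace {a r : Type*} [Fintype r] (M : Matrix (a × r) (a × r) ℂ) : Matrix a a ℂ :=
  Matrix.of fun x y => ∑ z : r, M (x, z) (y, z)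

/-- Partial trace over the `r`-systems of a matrix on `n` copies of `a × r`. -/
def ptraceN {a r : Type*} [Fintype r] {n : ℕ}
    (M : Matrix (Fin n → a × r) (Fin n → a × r) ℂ) :
    Matrix (Fin n → a) (Fin n → a) ℂ :=
  Matrix.of fun u u' => ∑ z : Fin n → r, M (fun i => (u i, z i)) (fun i => (u' i, z i))

/-- A matrix on `n` systems is permutation-invariant if conjugation by any
permutation of the systems leaves it unchanged. -/
def PermInvariant {d : Type*} {n : ℕ} (ρ : Matrix (Fin n → d) (Fin n → d) ℂ) : Prop :=
  ∀ (π : Equiv.Perm (Fin n)) (v w : Fin n → d), ρ (v ∘ π) (w ∘ π) = ρ v w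

/-- The Borel measurable structure on complex matrices (the product σ-algebra on
entries, which coincides with the Borel σ-algebra). -/
instance matrixMeasurableSpace {m : Type*} : MeasurableSpace (Matrix m m ℂ) :=
  inferInstanceAs (MeasurableSpace (m → m → ℂ))

section

open Matrix
open scoped Kronecker

lemma MvPolynomial.eq_zero_of_eval_unitary {r : Type*} [Fintype r] [DecidableEq r]
    (P : MvPolynomial (r × r) ℂ)
    (h : ∀ U ∈ Matrix.unitaryGroup r ℂ, MvPolynomial.eval (fun p => U p.1 p.2) P = 0) :
    P = 0 := by
  have hherm : ∀ H : Matrix r r ℂ, H.IsHermitian →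
      MvPolynomial.eval (fun p => H p.1 p.2) P = 0 := by
    intro H hH
    set U : Matrix r r ℂ := (hH.eigenvectorUnitary : Matrix r r ℂ) with hU
    have hUm : U ∈ Matrix.unitaryGroup r ℂ := hH.eigenvectorUnitary.2
    let Q : MvPolynomial r ℂ := MvPolynomial.bind₁
      (fun p : r × r => ∑ k, MvPolynomial.C (U p.1 k * star (U p.2 k)) * MvPolynomial.X k) P
    have hQ : ∀ d : r → ℂ, MvPolynomial.eval d Q =
        MvPolynomial.eval (fun p => (U * Matrix.diagonal d * star U) p.1 p.2) P := by
      intro d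
      simp only [Q, MvPolynomial.eval, MvPolynomial.eval₂Hom_bind₁]
      congr 2
      funext p
      rw [Matrix.mul_apply]
      simp only [map_sum, map_mul, MvPolynomial.eval₂Hom_C, MvPolynomial.eval₂Hom_X',
        RingHom.id_apply, Matrix.mul_diagonal, Matrix.star_apply]
      exact Finset.sum_congr rfl fun k _ => by ring
    have hQ0 : Q = 0 := by
      refine MvPolynomial.funext_set (fun _ => Metric.sphere (0 : ℂ) 1) (fun _ => ?_) fun d hd => ?_
      · refine (isPreconnected_sphere (by simp [Complex.rank_real_complex]) 0 1
          ).infinite_of_nontrivial ⟨1, by simp, -1, by simp, ?_⟩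
        norm_num
      · rw [hQ, map_zero]
        apply h
        refine mul_mem (mul_mem hUm ?_) (Unitary.star_mem hUm)
        rw [Matrix.mem_unitaryGroup_iff, Matrix.star_eq_conjTranspose,
          Matrix.diagonal_conjTranspose, Matrix.diagonal_mul_diagonal, ← Matrix.diagonal_one]
        congr 1
        funext i
        have := hd i trivial
        simp only [mem_sphere_iff_norm, sub_zero] at this
        simp [Complex.mul_conj, Complex.normSq_eq_norm_sq, this]
    have := hQ (fun i => (hH.eigenvalues i : ℂ))
    rw [hQ0, map_zero] at this
    have hs := hH.spectral_theorem
    rw [Unitary.conjStarAlgAut_apply] at hs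
    rw [hs]
    exact this.symm
  refine MvPolynomial.funext fun x => ?_
  rw [map_zero]
  let M : Matrix r r ℂ := Matrix.of fun i j => x (i, j)
  let H : Matrix r r ℂ := (2⁻¹ : ℂ) • (M + Mᴴ)
  let K : Matrix r r ℂ := (-Complex.I * 2⁻¹ : ℂ) • (M - Mᴴ)
  have hH : H.IsHermitian := by
    ext i j; simp [H]; ring
  have hK : K.IsHermitian := by
    ext i j; simp [K]; ring
  let q : Polynomial ℂ := MvPolynomial.aeval
    (fun p : r × r => Polynomial.C (H p.1 p.2) + Polynomial.X * Polynomial.C (K p.1 p.2)) P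
  have hq : ∀ z : ℂ, q.eval z = MvPolynomial.eval (fun p => H p.1 p.2 + z * K p.1 p.2) P := by
    intro z
    rw [← Polynomial.coe_evalRingHom]
    simp only [q]
    rw [MvPolynomial.map_aeval, MvPolynomial.eval]
    congr 2
    · ext; simp
    · funext p
      simpa using mul_comm _ _
  have hq0 : q = 0 := by
    apply Polynomial.eq_zero_of_infinite_isRoot
    refine (Set.infinite_range_of_injective Complex.ofReal_injective).mono ?_
    rintro _ ⟨t, rfl⟩
    change q.eval _ = 0
    rw [hq]
    refine hherm (H + (t : ℂ) • K) (hH.add ?_)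
    ext i j
    have := congrFun (congrFun hK i) j
    simp only [Matrix.conjTranspose_apply, Matrix.smul_apply, smul_eq_mul, star_mul'] at this ⊢
    simp [this]
  have := hq Complex.I
  rw [hq0, Polynomial.eval_zero] at this
  rw [this]
  congr 2
  funext p
  simp only [H, K, M, Matrix.smul_apply, Matrix.add_apply, Matrix.sub_apply, smul_eq_mul,
    Matrix.conjTranspose_apply, Matrix.of_apply, Prod.mk.eta]
  linear_combination (1/2 * (x p - star (x (p.2, p.1)))) * Complex.I_sq

lemma Matrix.linearMap_apply_eq_sum {m : Type*} [Fintype m] [DecidableEq m]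
    (Φ : Matrix m m ℂ →ₗ[ℂ] ℂ) (M : Matrix m m ℂ) :
    Φ M = ∑ i, ∑ j, M i j * Φ (Matrix.single i j 1) := by
  conv_lhs => rw [Matrix.matrix_eq_sum_single M]
  simp only [map_sum]
  refine Finset.sum_congr rfl fun i _ => Finset.sum_congr rfl fun j _ => ?_
  rw [← smul_eq_mul, ← map_smul, Matrix.smul_single, smul_eq_mul, mul_one]

/-- A permutation-invariant matrix on `n` systems lies in the span of the tensor powers of
unitary matrices. -/
lemma PermInvariant.mem_span_tensorPow_unitary {r : Type*} [Fintype r] [DecidableEq r] {n : ℕ}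
    {L : Matrix (Fin n → r) (Fin n → r) ℂ} (hL : PermInvariant L) :
    L ∈ Submodule.span ℂ
      (Set.range fun U : Matrix.unitaryGroup r ℂ => tensorPow (U : Matrix r r ℂ) n) := by
  by_contra hmem
  obtain ⟨Φ, hΦL, hΦ⟩ := Submodule.exists_dual_map_eq_bot_of_notMem hmem inferInstance
  apply hΦL
  have hΦU : ∀ U ∈ Matrix.unitaryGroup r ℂ, Φ (tensorPow U n) = 0 := fun U hU =>
    (Submodule.mem_bot ℂ).1 (hΦ ▸ Submodule.mem_map_of_mem (Submodule.subset_span ⟨⟨U, hU⟩, rfl⟩))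
  let φ : (Fin n → r × r) → ℂ := fun k =>
    Φ (Matrix.single (fun i => (k i).1) (fun i => (k i).2) 1)
  have hexp : ∀ M : Matrix (Fin n → r) (Fin n → r) ℂ,
      Φ M = ∑ k : Fin n → r × r, M (fun i => (k i).1) (fun i => (k i).2) * φ k := by
    intro M
    rw [Matrix.linearMap_apply_eq_sum, ← Fintype.sum_prod_type'
      (f := fun v w => M v w * Φ (Matrix.single v w 1))]
    exact (Fintype.sum_equiv (Equiv.arrowProdEquivProdArrow (Fin n) (fun _ => r) (fun _ => r))
      _ _ fun k => rfl).symm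
  let t : (Fin n → r × r) → (r × r →₀ ℕ) := fun k => ∑ i, Finsupp.single (k i) 1
  let P : MvPolynomial (r × r) ℂ := ∑ k, MvPolynomial.monomial (t k) (φ k)
  have hP : P = 0 := by
    refine MvPolynomial.eq_zero_of_eval_unitary P fun U hU => ?_
    rw [← hΦU U hU, hexp]
    simp only [P, t, map_sum, MvPolynomial.eval_monomial]
    refine Finset.sum_congr rfl fun k _ => ?_
    rw [mul_comm, ← Finsupp.prod_finsetSum_index (by simp) (by simp [pow_add])]
    simp [tensorPow]
  have hcoef : ∀ s, ∑ k with t k = s, φ k = 0 := by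
    intro s
    have := congrArg (MvPolynomial.coeff s) hP
    simpa [P, MvPolynomial.coeff_sum, MvPolynomial.coeff_monomial, Finset.sum_filter] using this
  have hperm : ∀ k k', t k = t k' → ∃ π : Equiv.Perm (Fin n), k' ∘ π = k := by
    intro k k' h
    have hc : ∀ c, Fintype.card {i // k i = c} = Fintype.card {i // k' i = c} := by
      intro c
      have := DFunLike.congr_fun h c
      simpa [t, Finsupp.finsetSum_apply, Finsupp.single_apply, Fintype.card_subtype] using this
    exact ⟨Equiv.ofFiberEquiv fun c => Fintype.equivOfCardEq (hc c),
      funext fun i => Equiv.ofFiberEquiv_map _ i⟩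
  rw [hexp, ← Finset.sum_fiberwise_of_maps_to (t := Finset.univ.image t) (g := t) (by simp)]
  refine Finset.sum_eq_zero fun s hs => ?_
  obtain ⟨k₀, -, rfl⟩ := Finset.mem_image.1 hs
  rw [← mul_zero (L (fun i => (k₀ i).1) (fun i => (k₀ i).2)), ← hcoef (t k₀), Finset.mul_sum]
  refine Finset.sum_congr rfl fun k hk => ?_
  obtain ⟨π, rfl⟩ := hperm k k₀ (Finset.mem_filter.1 hk).2
  congr 1
  exact hL π (fun i => (k₀ i).1) (fun i => (k₀ i).2)

section Twirl

variable {G ι : Type*} [Group G] [Fintype ι] [DecidableEq ι]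

lemma conjTranspose_comm_of_comm (D : G →* Matrix.unitaryGroup ι ℂ) {X : Matrix ι ι ℂ}
    (hX : ∀ g, X * D g = D g * X) (g : G) :
    Xᴴ * D g = D g * Xᴴ := by
  have h := congrArg Matrix.conjTranspose (hX g⁻¹)
  rw [Matrix.conjTranspose_mul, Matrix.conjTranspose_mul, map_inv, ← Unitary.star_eq_inv,
    Unitary.coe_star, Matrix.star_eq_conjTranspose, Matrix.conjTranspose_conjTranspose] at h
  exact h.symm

variable [MeasurableSpace G]

/-- The average `∫ D g * A * (D g)ᴴ ∂μ`, taken entrywise. -/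
def twirl (μ : Measure G) (D : G →* Matrix.unitaryGroup ι ℂ) (A : Matrix ι ι ℂ) :
    Matrix ι ι ℂ :=
  Matrix.of fun i j => ∫ g, ((D g : Matrix ι ι ℂ) * A * (D g : Matrix ι ι ℂ)ᴴ) i j ∂μ

variable (μ : Measure G) (D : G →* Matrix.unitaryGroup ι ℂ)

lemma conjTranspose_twirl (A : Matrix ι ι ℂ) : (twirl μ D A)ᴴ = twirl μ D Aᴴ := by
  ext i j
  simp only [twirl, Matrix.conjTranspose_apply, Matrix.of_apply]
  rw [RCLike.star_def, ← integral_conj]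
  congr 1
  funext g
  rw [← RCLike.star_def, ← Matrix.conjTranspose_apply]
  simp only [Matrix.conjTranspose_mul, Matrix.conjTranspose_conjTranspose, Matrix.mul_assoc]

variable [TopologicalSpace G] [BorelSpace G] [CompactSpace G] [IsProbabilityMeasure μ]

lemma integrable_linearMap_conj (hD : Continuous D) (A : Matrix ι ι ℂ)
    (Φ : Matrix ι ι ℂ →ₗ[ℂ] ℂ) :
    Integrable (fun g => Φ ((D g : Matrix ι ι ℂ) * A * (D g : Matrix ι ι ℂ)ᴴ)) μ := by
  have h : Continuous fun g => (D g : Matrix ι ι ℂ) * A * (D g : Matrix ι ι ℂ)ᴴ := by fun_prop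
  have hΦ : Continuous Φ := Φ.continuous_of_finiteDimensional
  exact (hΦ.comp h).integrable_of_hasCompactSupport (HasCompactSupport.of_compactSpace _)

lemma linearMap_twirl (hD : Continuous D) (A : Matrix ι ι ℂ) (Φ : Matrix ι ι ℂ →ₗ[ℂ] ℂ) :
    Φ (twirl μ D A) = ∫ g, Φ ((D g : Matrix ι ι ℂ) * A * (D g : Matrix ι ι ℂ)ᴴ) ∂μ := by
  have hint : ∀ i j, Integrable
      (fun g => ((D g : Matrix ι ι ℂ) * A * (D g : Matrix ι ι ℂ)ᴴ) i j) μ := fun i j =>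
    integrable_linearMap_conj μ D hD A (Matrix.entryLinearMap ℂ ℂ i j)
  rw [Matrix.linearMap_apply_eq_sum Φ]
  conv_rhs => enter [2, g]; rw [Matrix.linearMap_apply_eq_sum Φ]
  rw [integral_finsetSum _ fun i _ => integrable_finsetSum _ fun j _ => (hint i j).mul_const _]
  refine Finset.sum_congr rfl fun i _ => ?_
  rw [integral_finsetSum _ fun j _ => (hint i j).mul_const _]
  refine Finset.sum_congr rfl fun j _ => ?_
  rw [integral_mul_const]
  rfl

lemma mul_twirl (hD : Continuous D) {X : Matrix ι ι ℂ} (hX : ∀ g, X * D g = D g * X)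
    (A : Matrix ι ι ℂ) : X * twirl μ D A = twirl μ D (X * A) := by
  ext i j
  refine (linearMap_twirl μ D hD A
    (Matrix.entryLinearMap ℂ ℂ i j ∘ₗ LinearMap.mulLeft ℂ X)).trans ?_
  refine integral_congr_ae (Filter.Eventually.of_forall fun g => ?_)
  simp [← Matrix.mul_assoc, hX]

lemma twirl_mul (hD : Continuous D) {X : Matrix ι ι ℂ} (hX : ∀ g, X * D g = D g * X)
    (A : Matrix ι ι ℂ) : twirl μ D A * X = twirl μ D (A * X) := by
  have h := congrArg Matrix.conjTranspose
    (mul_twirl μ D hD (conjTranspose_comm_of_comm D hX) Aᴴ)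
  simpa [conjTranspose_twirl] using h

lemma trace_twirl (hD : Continuous D) (A : Matrix ι ι ℂ) :
    (twirl μ D A).trace = A.trace := by
  refine (linearMap_twirl μ D hD A (Matrix.traceLinearMap ι ℂ ℂ)).trans ?_
  have : ∀ g, ((D g : Matrix ι ι ℂ) * A * (D g : Matrix ι ι ℂ)ᴴ).trace = A.trace := by
    intro g
    rw [Matrix.trace_mul_comm, ← Matrix.mul_assoc, ← Matrix.star_eq_conjTranspose,
      Unitary.coe_star_mul_self, Matrix.one_mul]
  simp [this]

lemma twirl_comm [IsTopologicalGroup G] [μ.IsMulLeftInvariant] (hD : Continuous D)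
    (A : Matrix ι ι ℂ) (h : G) :
    twirl μ D A * D h = D h * twirl μ D A := by
  have key : (D h : Matrix ι ι ℂ) * (twirl μ D A * (D h : Matrix ι ι ℂ)ᴴ) = twirl μ D A := by
    ext i j
    refine (linearMap_twirl μ D hD A (Matrix.entryLinearMap ℂ ℂ i j ∘ₗ
      LinearMap.mulLeft ℂ (D h : Matrix ι ι ℂ) ∘ₗ
      LinearMap.mulRight ℂ (D h : Matrix ι ι ℂ)ᴴ)).trans ?_
    refine Eq.trans ?_ (integral_mul_left_eq_self
        (fun g => ((D g : Matrix ι ι ℂ) * A * (D g : Matrix ι ι ℂ)ᴴ) i j) h)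
    refine integral_congr_ae (Filter.Eventually.of_forall fun g => ?_)
    simp [Matrix.mul_assoc]
  conv_lhs => rw [← key]
  rw [Matrix.mul_assoc, Matrix.mul_assoc, ← Matrix.star_eq_conjTranspose,
    Unitary.coe_star_mul_self, Matrix.mul_one]

lemma dotProduct_twirl (hD : Continuous D) (A : Matrix ι ι ℂ) (x y : ι → ℂ) :
    x ⬝ᵥ (twirl μ D A *ᵥ y) =
      ∫ g, x ⬝ᵥ (((D g : Matrix ι ι ℂ) * A * (D g : Matrix ι ι ℂ)ᴴ) *ᵥ y) ∂μ :=
  linearMap_twirl μ D hD A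
    { toFun := fun M => x ⬝ᵥ (M *ᵥ y)
      map_add' := fun M N => by rw [Matrix.add_mulVec, dotProduct_add]
      map_smul' := fun c M => by rw [Matrix.smul_mulVec, dotProduct_smul, RingHom.id_apply] }

lemma posSemidef_twirl (hD : Continuous D) {A : Matrix ι ι ℂ} (hA : A.PosSemidef) :
    (twirl μ D A).PosSemidef := by
  refine Matrix.PosSemidef.of_dotProduct_mulVec_nonneg ?_ fun x => ?_
  · rw [Matrix.IsHermitian, conjTranspose_twirl, hA.isHermitian.eq]
  · rw [dotProduct_twirl μ D hD]
    exact integral_nonneg fun g => (hA.mul_mul_conjTranspose_same _).dotProduct_mulVec_nonneg x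

lemma mem_range_twirl_vecMulVec [μ.IsOpenPosMeasure] (hD : Continuous D) (w : ι → ℂ) :
    ∃ z, twirl μ D (vecMulVec w (star w)) *ᵥ z = w := by
  set T := twirl μ D (vecMulVec w (star w)) with hT
  have hTP : T.PosSemidef := posSemidef_twirl μ D hD (Matrix.posSemidef_vecMulVec_self_star w)
  by_contra hw
  have hmem : w ∉ LinearMap.range T.mulVecLin := fun ⟨z, hz⟩ => hw ⟨z, hz⟩
  obtain ⟨f, hfw, hf⟩ := Submodule.exists_dual_map_eq_bot_of_notMem hmem inferInstance
  obtain ⟨y, rfl⟩ := (dotProductEquiv ℂ ι).surjective f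
  apply hfw
  have hy : y ⬝ᵥ (T *ᵥ star y) = 0 :=
    (Submodule.mem_bot ℂ).1 (hf ▸ Submodule.mem_map_of_mem ⟨star y, rfl⟩)
  have hform : ∀ g, y ⬝ᵥ (((D g : Matrix ι ι ℂ) * vecMulVec w (star w) *
      (D g : Matrix ι ι ℂ)ᴴ) *ᵥ star y) = ((‖y ⬝ᵥ ((D g : Matrix ι ι ℂ) *ᵥ w)‖ ^ 2 : ℝ) : ℂ) := by
    intro g
    rw [Matrix.mul_vecMulVec, Matrix.vecMulVec_mul, ← Matrix.star_mulVec,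
      Matrix.vecMulVec_mulVec, dotProduct_smul, Matrix.star_dotProduct_star, op_smul_eq_mul,
      RCLike.star_def, Complex.mul_conj, Complex.normSq_eq_norm_sq]
  rw [hT, dotProduct_twirl μ D hD] at hy
  simp_rw [hform] at hy
  rw [integral_complex_ofReal, Complex.ofReal_eq_zero,
    integral_eq_zero_iff_of_nonneg (fun g => by positivity)] at hy
  · have hc : Continuous fun g => ‖y ⬝ᵥ ((D g : Matrix ι ι ℂ) *ᵥ w)‖ ^ 2 := by fun_prop
    have := congrFun ((hc.ae_eq_iff_eq μ (g := 0) continuous_const).1 hy) 1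
    rw [Pi.zero_apply] at this
    rw [dotProductEquiv_apply_apply]
    simpa only [map_one, OneMemClass.coe_one, Matrix.one_mulVec,
      sq_eq_zero_iff, norm_eq_zero] using this
  · have hc : Continuous fun g => ‖y ⬝ᵥ ((D g : Matrix ι ι ℂ) *ᵥ w)‖ ^ 2 := by fun_prop
    exact hc.integrable_of_hasCompactSupport (HasCompactSupport.of_compactSpace _)

end Twirl

lemma Matrix.trace_mul_eq_rank {ι : Type*} [Fintype ι] [DecidableEq ι] {T Z : Matrix ι ι ℂ}
    (h : T * Z * T = T) : (T * Z).trace = T.rank := by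
  have hp : LinearMap.IsProj (LinearMap.range T.mulVecLin) (T * Z).mulVecLin := by
    refine ⟨fun x => ⟨Z *ᵥ x, by simp⟩, ?_⟩
    rintro _ ⟨x, rfl⟩
    rw [Matrix.mulVecLin_apply, Matrix.mulVecLin_apply, Matrix.mulVec_mulVec, h]
  rw [← Matrix.trace_toLin'_eq, Matrix.rank]
  exact hp.trace

open scoped MatrixOrder in
lemma Matrix.PosSemidef.smul_sub_vecMulVec {ι : Type*} [Fintype ι] [DecidableEq ι]
    {T : Matrix ι ι ℂ} (hT : T.PosSemidef) (q : ι → ℂ) :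
    ((star q ⬝ᵥ (T *ᵥ q)) • T - vecMulVec (T *ᵥ q) (star (T *ᵥ q))).PosSemidef := by
  obtain ⟨B, rfl⟩ := CStarAlgebra.nonneg_iff_eq_star_mul_self.mp hT.nonneg
  rw [Matrix.star_eq_conjTranspose]
  set v := B *ᵥ q with hv
  have h1 : star q ⬝ᵥ ((Bᴴ * B) *ᵥ q) = star v ⬝ᵥ v := by
    rw [← Matrix.mulVec_mulVec, Matrix.dotProduct_mulVec, hv, Matrix.star_mulVec]
  have h2 : (star v ⬝ᵥ v) • (Bᴴ * B) - vecMulVec ((Bᴴ * B) *ᵥ q) (star ((Bᴴ * B) *ᵥ q)) =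
      Bᴴ * ((star v ⬝ᵥ v) • 1 - vecMulVec v (star v)) * B := by
    rw [← Matrix.mulVec_mulVec, ← hv, Matrix.star_mulVec Bᴴ, Matrix.conjTranspose_conjTranspose,
      ← Matrix.mul_vecMulVec, ← Matrix.vecMulVec_mul]
    simp [Matrix.mul_sub, Matrix.sub_mul, Matrix.mul_assoc]
  rw [h1, h2]
  refine Matrix.PosSemidef.conjTranspose_mul_mul_same ?_ B
  refine Matrix.PosSemidef.of_dotProduct_mulVec_nonneg ?_ fun x => ?_
  · rw [Matrix.IsHermitian, Matrix.conjTranspose_sub, Matrix.conjTranspose_smul,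
      Matrix.conjTranspose_one, ← Matrix.star_dotProduct,
      (Matrix.posSemidef_vecMulVec_self_star v).isHermitian.eq]
  · have hsq : ∀ z : ι → ℂ, star z ⬝ᵥ z = ((‖WithLp.toLp 2 z‖ ^ 2 : ℝ) : ℂ) := fun z => by
      rw [dotProduct_comm, ← EuclideanSpace.inner_toLp_toLp, inner_self_eq_norm_sq_to_K]
      simp
    have hcs := norm_inner_le_norm (𝕜 := ℂ) (WithLp.toLp 2 x) (WithLp.toLp 2 v)
    rw [EuclideanSpace.inner_toLp_toLp, dotProduct_comm] at hcs
    rw [Matrix.sub_mulVec, Matrix.smul_mulVec, Matrix.one_mulVec, dotProduct_sub, dotProduct_smul,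
      Matrix.vecMulVec_mulVec, dotProduct_smul, op_smul_eq_mul,
      Matrix.star_dotProduct v x, RCLike.star_def, Complex.mul_conj, Complex.normSq_eq_norm_sq, hsq,
      hsq, smul_eq_mul, ← Complex.ofReal_mul, ← Complex.ofReal_sub, Complex.zero_le_real,
      sub_nonneg, ← mul_pow, mul_comm ‖WithLp.toLp 2 v‖]
    gcongr

/-- If `M` is a linear combination of the unitaries `D g` and `Mᴴ * M` fixes `w`, then the rank-one
matrix of `M w` is dominated by the average of the rank-one matrices of `D g w`, up to the rank of
that average. -/
lemma posSemidef_rank_smul_twirl_sub {G ι : Type*} [Group G] [MeasurableSpace G] [Fintype ι]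
    [DecidableEq ι] [TopologicalSpace G] [BorelSpace G] [CompactSpace G] [IsTopologicalGroup G]
    (μ : Measure G) [IsProbabilityMeasure μ] [μ.IsMulLeftInvariant] [μ.IsOpenPosMeasure]
    (D : G →* Matrix.unitaryGroup ι ℂ) (hD : Continuous D) (w : ι → ℂ) {M : Matrix ι ι ℂ}
    (hM : M ∈ Submodule.span ℂ (Set.range fun g => (D g : Matrix ι ι ℂ)))
    (hMw : (Mᴴ * M) *ᵥ w = w) :
    (((twirl μ D (vecMulVec w (star w))).rank : ℂ) • twirl μ D (vecMulVec w (star w)) -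
      vecMulVec (M *ᵥ w) (star (M *ᵥ w))).PosSemidef := by
  obtain ⟨z, hz⟩ := mem_range_twirl_vecMulVec μ D hD w
  set T := twirl μ D (vecMulVec w (star w)) with hT
  have hTP : T.PosSemidef := posSemidef_twirl μ D hD (Matrix.posSemidef_vecMulVec_self_star w)
  have hTD : ∀ g, T * D g = D g * T := twirl_comm μ D hD _
  have hTM : T * M = M * T := by
    clear hMw
    induction hM using Submodule.span_induction with
    | mem x hx => obtain ⟨g, rfl⟩ := hx; exact hTD g
    | zero => simp
    | add x y _ _ hx hy => rw [Matrix.mul_add, Matrix.add_mul, hx, hy]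
    | smul a x _ hx => rw [Matrix.mul_smul, Matrix.smul_mul, hx]
  have hTZ : T * twirl μ D (vecMulVec z (star z)) = twirl μ D (vecMulVec w (star z)) := by
    rw [mul_twirl μ D hD hTD, Matrix.mul_vecMulVec, hz]
  have hrank : w ⬝ᵥ star z = T.rank := by
    rw [← Matrix.trace_vecMulVec, ← trace_twirl μ D hD, ← hTZ]
    apply Matrix.trace_mul_eq_rank
    have hzT : star z ᵥ* T = star w := by
      rw [← hz, Matrix.star_mulVec, hTP.isHermitian.eq]
    rw [hTZ, twirl_mul μ D hD hTD, Matrix.vecMulVec_mul, hzT]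
  have hq := hTP.smul_sub_vecMulVec (M *ᵥ z)
  have hTq : T *ᵥ (M *ᵥ z) = M *ᵥ w := by
    rw [Matrix.mulVec_mulVec, hTM, ← Matrix.mulVec_mulVec, hz]
  rwa [hTq, Matrix.star_mulVec, ← Matrix.dotProduct_mulVec, Matrix.mulVec_mulVec, hMw,
    dotProduct_comm, hrank] at hq

/-- `n`-fold tensor power of a rectangular matrix. -/
def Matrix.rectTensorPow {a b : Type*} (M : Matrix a b ℂ) (n : ℕ) :
    Matrix (Fin n → a) (Fin n → b) ℂ :=
  Matrix.of fun v w => ∏ i, M (v i) (w i)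

section RectTensorPow

variable {a b c : Type*} {n : ℕ}

lemma Matrix.rectTensorPow_mul [Fintype b] (M : Matrix a b ℂ) (N : Matrix b c ℂ) :
    (M * N).rectTensorPow n = M.rectTensorPow n * N.rectTensorPow n := by
  classical
  ext v w
  simp only [Matrix.rectTensorPow, Matrix.of_apply, Matrix.mul_apply, Finset.prod_univ_sum,
    Fintype.piFinset_univ, Finset.prod_mul_distrib]

lemma Matrix.conjTranspose_rectTensorPow (M : Matrix a b ℂ) :
    (M.rectTensorPow n)ᴴ = Mᴴ.rectTensorPow n := by
  ext v w
  simp [Matrix.rectTensorPow]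

lemma Matrix.transpose_rectTensorPow (M : Matrix a b ℂ) :
    (M.rectTensorPow n)ᵀ = Mᵀ.rectTensorPow n := rfl

lemma Matrix.rectTensorPow_one [DecidableEq a] :
    (1 : Matrix a a ℂ).rectTensorPow n = 1 := by
  ext v w
  simp [Matrix.rectTensorPow, Matrix.one_apply, Finset.prod_ite_zero, funext_iff]

lemma PermInvariant.transpose {L : Matrix (Fin n → a) (Fin n → a) ℂ} (hL : PermInvariant L) :
    PermInvariant Lᵀ := fun π v w => hL π w v

open scoped MatrixOrder in
lemma PermInvariant.sqrt [Fintype a] [DecidableEq a] {ρ : Matrix (Fin n → a) (Fin n → a) ℂ}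
    (hρ : ρ.PosSemidef) (h : PermInvariant ρ) : PermInvariant (CFC.sqrt ρ) := by
  intro π v w
  let e : (Fin n → a) ≃ (Fin n → a) := Equiv.arrowCongr π.symm (Equiv.refl a)
  have hs : (CFC.sqrt ρ).PosSemidef := (CFC.sqrt_nonneg ρ).posSemidef
  have : CFC.sqrt ρ = (CFC.sqrt ρ).submatrix e e := by
    refine CFC.sqrt_unique ?_ (hs.submatrix e).nonneg
    rw [Matrix.submatrix_mul_equiv, CFC.sqrt_mul_sqrt_self ρ hρ.nonneg]
    ext v w
    exact h π v w
  exact (congrFun (congrFun this v) w).symm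

lemma Matrix.PosSemidef.exists_sqrt_pseudoinverse [Fintype a] [DecidableEq a] {A : Matrix a a ℂ}
    (hA : A.PosSemidef) :
    ∃ s N : Matrix a a ℂ, s * s = A ∧ sᴴ = s ∧ Nᴴ = N ∧ s * N = N * s ∧ s * N * s = s := by
  have hH := hA.isHermitian
  set φ := Unitary.conjStarAlgAut ℂ (Matrix a a ℂ) hH.eigenvectorUnitary
  have hstar : ∀ d : a → ℝ, (φ (Matrix.diagonal fun i => (d i : ℂ)))ᴴ =
      φ (Matrix.diagonal fun i => (d i : ℂ)) := by
    intro d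
    rw [← Matrix.star_eq_conjTranspose, ← map_star, Matrix.star_eq_conjTranspose,
      Matrix.diagonal_conjTranspose]
    congr 2
    funext i
    simp
  refine ⟨φ (Matrix.diagonal fun i => ((√(hH.eigenvalues i) : ℝ) : ℂ)),
    φ (Matrix.diagonal fun i => (((√(hH.eigenvalues i))⁻¹ : ℝ) : ℂ)), ?_, hstar _, hstar _, ?_, ?_⟩
  · conv_rhs => rw [hH.spectral_theorem]
    rw [← map_mul, Matrix.diagonal_mul_diagonal]
    congr 2
    funext i
    rw [← Complex.ofReal_mul, Real.mul_self_sqrt (hA.eigenvalues_nonneg i)]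
    rfl
  · rw [← map_mul, ← map_mul, Matrix.diagonal_mul_diagonal, Matrix.diagonal_mul_diagonal]
    simp_rw [mul_comm]
  · rw [← map_mul, ← map_mul, Matrix.diagonal_mul_diagonal, Matrix.diagonal_mul_diagonal]
    simp_rw [← Complex.ofReal_mul, mul_inv_mul_cancel]

end RectTensorPow

instance Matrix.compactSpace_unitaryGroup {r : Type*} [Fintype r] [DecidableEq r] :
    CompactSpace (Matrix.unitaryGroup r ℂ) := by
  refine isCompact_iff_compactSpace.1
    (show IsCompact (Matrix.unitaryGroup r ℂ : Set (Matrix r r ℂ)) from ?_)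
  have hK : IsCompact (Set.univ.pi fun _ : r => Set.univ.pi fun _ : r =>
      Metric.closedBall (0 : ℂ) 1) :=
    isCompact_univ_pi fun _ => isCompact_univ_pi fun _ => isCompact_closedBall _ _
  refine IsCompact.of_isClosed_subset (X := Matrix r r ℂ) hK ?_ fun U hU i _ j _ => ?_
  · have : (Matrix.unitaryGroup r ℂ : Set (Matrix r r ℂ)) = {U | U * star U = 1} := by
      ext U
      exact Matrix.mem_unitaryGroup_iff
    rw [this]
    exact isClosed_eq (by fun_prop) continuous_const
  · simpa using entry_norm_bound_of_unitary hU i j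

section Representation

variable {a r : Type*} [Fintype a] [DecidableEq a] [Fintype r] [DecidableEq r]

variable (a) in
/-- The representation `U ↦ U^⊗n ⊗ 1` of the unitary group. -/
def tensorPowRep (n : ℕ) :
    Matrix.unitaryGroup r ℂ →* Matrix.unitaryGroup ((Fin n → r) × (Fin n → a)) ℂ where
  toFun U := ⟨(U : Matrix r r ℂ).rectTensorPow n ⊗ₖ 1,
    Matrix.kronecker_mem_unitary (by
      rw [Matrix.mem_unitaryGroup_iff, Matrix.star_eq_conjTranspose,
        Matrix.conjTranspose_rectTensorPow, ← Matrix.rectTensorPow_mul,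
        ← Matrix.star_eq_conjTranspose, Matrix.mem_unitaryGroup_iff.1 U.2, Matrix.rectTensorPow_one])
      (one_mem _)⟩
  map_one' := Subtype.ext (by simp [Matrix.rectTensorPow_one])
  map_mul' U V := Subtype.ext (by
    simp [Matrix.rectTensorPow_mul, ← Matrix.mul_kronecker_mul])

lemma continuous_tensorPowRep (n : ℕ) : Continuous (tensorPowRep (r := r) a n) := by
  refine Continuous.subtype_mk (continuous_matrix fun x y => ?_) _
  have h : ∀ i j, Continuous fun U : Matrix.unitaryGroup r ℂ => (U : Matrix r r ℂ) i j :=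
    fun i j => continuous_subtype_val.matrix_elem i j
  change Continuous fun U : Matrix.unitaryGroup r ℂ =>
    (∏ i, (U : Matrix r r ℂ) (x.1 i) (y.1 i)) * (1 : Matrix (Fin n → a) (Fin n → a) ℂ) x.2 y.2
  exact (continuous_finsetProd _ fun i _ => h (x.1 i) (y.1 i)).mul continuous_const

lemma tensorPowRep_mulVec_vec {n : ℕ} (S : Matrix a r ℂ) (U : Matrix.unitaryGroup r ℂ) :
    (tensorPowRep a n U : Matrix _ _ ℂ) *ᵥ vec (S.rectTensorPow n) =
      vec ((S * (U : Matrix r r ℂ)ᵀ).rectTensorPow n) := by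
  change ((U : Matrix r r ℂ).rectTensorPow n ⊗ₖ 1) *ᵥ _ = _
  rw [Matrix.kronecker_mulVec_vec, Matrix.one_mul, Matrix.transpose_rectTensorPow,
    Matrix.rectTensorPow_mul]

lemma twirl_tensorPowRep_apply [MeasurableSpace (Matrix.unitaryGroup r ℂ)]
    (μ : Measure (Matrix.unitaryGroup r ℂ)) {n : ℕ} (S : Matrix a r ℂ)
    (x y : (Fin n → r) × (Fin n → a)) :
    twirl μ (tensorPowRep a n)
        (vecMulVec (vec (S.rectTensorPow n)) (star (vec (S.rectTensorPow n)))) x y =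
      ∫ U, (∏ i, (S * (U : Matrix r r ℂ)ᵀ) (x.2 i) (x.1 i)) *
        star (∏ i, (S * (U : Matrix r r ℂ)ᵀ) (y.2 i) (y.1 i)) ∂μ := by
  simp only [twirl, Matrix.of_apply]
  congr 1
  funext U
  rw [Matrix.mul_vecMulVec, Matrix.vecMulVec_mul, ← Matrix.star_mulVec, tensorPowRep_mulVec_vec]
  rfl

lemma rank_twirl_tensorPowRep_le [MeasurableSpace (Matrix.unitaryGroup r ℂ)]
    (μ : Measure (Matrix.unitaryGroup r ℂ)) {n : ℕ} (S : Matrix a r ℂ) :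
    (twirl μ (tensorPowRep a n)
        (vecMulVec (vec (S.rectTensorPow n)) (star (vec (S.rectTensorPow n))))).rank ≤
      (Fintype.card a * Fintype.card r + n - 1).choose n := by
  set T := twirl μ (tensorPowRep a n)
    (vecMulVec (vec (S.rectTensorPow n)) (star (vec (S.rectTensorPow n)))) with hT
  let sym : (Fin n → r) × (Fin n → a) → Sym (a × r) n := fun x =>
    ⟨Finset.univ.val.map fun i => (x.2 i, x.1 i), by simp⟩
  have hprod : ∀ (N : Matrix a r ℂ) (x : (Fin n → r) × (Fin n → a)),
      ∏ i, N (x.2 i) (x.1 i) = ((sym x : Multiset (a × r)).map fun p => N p.1 p.2).prod := by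
    intro N x
    change _ = (((Finset.univ : Finset (Fin n)).val.map fun i => (x.2 i, x.1 i)).map
      fun p => N p.1 p.2).prod
    rw [Multiset.map_map]
    rfl
  have hfac : Function.FactorsThrough (fun x y => T x y) sym := by
    intro x x' h
    funext y
    simp only [hT, twirl_tensorPowRep_apply, hprod, h]
  let X : Matrix (Sym (a × r) n) ((Fin n → r) × (Fin n → a)) ℂ :=
    Matrix.of (Function.extend sym (fun x y => T x y) 0)
  have hTX : T = (1 : Matrix (Sym (a × r) n) (Sym (a × r) n) ℂ).submatrix sym id * X := by
    ext x y
    simp only [Matrix.mul_apply, Matrix.submatrix_apply, Matrix.one_apply, id, ite_mul, one_mul,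
      zero_mul, Finset.sum_ite_eq, Finset.mem_univ, if_true]
    simp only [X, Matrix.of_apply, hfac.extend_apply]
  rw [hTX, ← Fintype.card_prod, ← Sym.card_sym_eq_choose]
  exact (Matrix.rank_mul_le_left _ _).trans (Matrix.rank_le_card_width _)

lemma kronecker_mem_span_tensorPowRep {n : ℕ} {L : Matrix (Fin n → r) (Fin n → r) ℂ}
    (hL : PermInvariant L) :
    L ⊗ₖ (1 : Matrix (Fin n → a) (Fin n → a) ℂ) ∈ Submodule.span ℂ
      (Set.range fun U : Matrix.unitaryGroup r ℂ => (tensorPowRep a n U : Matrix _ _ ℂ)) := by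
  have h := Submodule.mem_map_of_mem
    (f := (Matrix.kroneckerBilinear (R := ℂ) (α := ℂ) (l := Fin n → r) (m := Fin n → r)).flip
      (1 : Matrix (Fin n → a) (Fin n → a) ℂ))
    hL.mem_span_tensorPow_unitary
  rw [Submodule.map_span, ← Set.range_comp] at h
  exact h

end Representation

lemma posSemidef_choose_smul_twirl_sub {a r : Type*} [Fintype a] [DecidableEq a] [Fintype r]
    [DecidableEq r] [MeasurableSpace (Matrix.unitaryGroup r ℂ)]
    [BorelSpace (Matrix.unitaryGroup r ℂ)] (μ : Measure (Matrix.unitaryGroup r ℂ))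
    [IsProbabilityMeasure μ] [μ.IsMulLeftInvariant] [μ.IsOpenPosMeasure] {n : ℕ}
    (S : Matrix a r ℂ) {L : Matrix (Fin n → r) (Fin n → r) ℂ} (hL : PermInvariant L)
    (hSL : S.rectTensorPow n * L * Lᴴ = S.rectTensorPow n) :
    (((Fintype.card a * Fintype.card r + n - 1).choose n : ℂ) •
        twirl μ (tensorPowRep a n)
          (vecMulVec (vec (S.rectTensorPow n)) (star (vec (S.rectTensorPow n)))) -
      vecMulVec (vec (S.rectTensorPow n * L)) (star (vec (S.rectTensorPow n * L)))).PosSemidef := by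
  have hM : (Lᵀ ⊗ₖ (1 : Matrix (Fin n → a) (Fin n → a) ℂ)) *ᵥ vec (S.rectTensorPow n) =
      vec (S.rectTensorPow n * L) := by
    rw [Matrix.kronecker_mulVec_vec, Matrix.one_mul, Matrix.transpose_transpose]
  have hMM : ((Lᵀ ⊗ₖ (1 : Matrix (Fin n → a) (Fin n → a) ℂ))ᴴ *
      (Lᵀ ⊗ₖ (1 : Matrix (Fin n → a) (Fin n → a) ℂ))) *ᵥ vec (S.rectTensorPow n) =
      vec (S.rectTensorPow n) := by
    rw [← Matrix.mulVec_mulVec, hM, Matrix.conjTranspose_kronecker, Matrix.conjTranspose_one,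
      Matrix.kronecker_mulVec_vec, Matrix.one_mul]
    exact congrArg vec hSL
  have key := posSemidef_rank_smul_twirl_sub μ (tensorPowRep a n) (continuous_tensorPowRep n)
    (vec (S.rectTensorPow n)) (kronecker_mem_span_tensorPowRep hL.transpose) hMM
  rw [hM] at key
  have hT : (twirl μ (tensorPowRep a n)
      (vecMulVec (vec (S.rectTensorPow n)) (star (vec (S.rectTensorPow n))))).PosSemidef :=
    posSemidef_twirl μ _ (continuous_tensorPowRep n) (Matrix.posSemidef_vecMulVec_self_star _)
  have hc := sub_nonneg.2 (Nat.cast_le (α := ℂ).2 (rank_twirl_tensorPowRep_le μ S (n := n)))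
  convert key.add (hT.smul hc) using 1
  rw [sub_smul]
  abel

/-- A permutation-invariant purification of `A^⊗n` factors through a purification of `A`. -/
lemma exists_permInvariant_factor {a r : Type*} [Fintype a] [DecidableEq a] [Fintype r]
    [DecidableEq r] {n : ℕ} {A : Matrix a a ℂ} (hA : A.PosSemidef) {J : Matrix a r ℂ}
    (hJ : J * Jᴴ = 1) {Y : Matrix (Fin n → a) (Fin n → r) ℂ}
    (hY : ∀ (π : Equiv.Perm (Fin n)) v w, Y (v ∘ π) (w ∘ π) = Y v w)
    (hYA : Y * Yᴴ = A.rectTensorPow n) :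
    ∃ (S : Matrix a r ℂ) (L : Matrix (Fin n → r) (Fin n → r) ℂ), S * Sᴴ = A ∧ PermInvariant L ∧
      S.rectTensorPow n * L = Y ∧ S.rectTensorPow n * L * Lᴴ = S.rectTensorPow n := by
  obtain ⟨s, N, hss, hs, hN, hsN, hsNs⟩ := hA.exists_sqrt_pseudoinverse
  have hE : (s * N).rectTensorPow n * Y = Y := by
    have hEA : (s * N).rectTensorPow n * A.rectTensorPow n = A.rectTensorPow n := by
      rw [← Matrix.rectTensorPow_mul, ← hss, ← Matrix.mul_assoc, hsNs]
    rw [← hYA, ← Matrix.mul_assoc] at hEA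
    rw [← sub_eq_zero, ← Matrix.self_mul_conjTranspose_eq_zero, Matrix.conjTranspose_sub,
      Matrix.conjTranspose_mul, Matrix.mul_sub, Matrix.sub_mul, Matrix.sub_mul,
      ← Matrix.mul_assoc, ← Matrix.mul_assoc, hEA, sub_self, sub_self, sub_zero]
  have hSL : (s * J).rectTensorPow n * ((Jᴴ * N).rectTensorPow n * Y) = Y := by
    rw [← Matrix.mul_assoc, ← Matrix.rectTensorPow_mul, Matrix.mul_assoc s, ← Matrix.mul_assoc J,
      hJ, Matrix.one_mul, hE]
  refine ⟨s * J, (Jᴴ * N).rectTensorPow n * Y, ?_, fun π v w => ?_, hSL, ?_⟩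
  · rw [Matrix.conjTranspose_mul, Matrix.mul_assoc, ← Matrix.mul_assoc J, hJ, Matrix.one_mul, hs,
      hss]
  · simp only [Matrix.mul_apply]
    rw [← (Equiv.arrowCongr π.symm (Equiv.refl a)).sum_comp]
    refine Finset.sum_congr rfl fun x _ => ?_
    change (Jᴴ * N).rectTensorPow n (v ∘ π) (x ∘ π) * Y (x ∘ π) (w ∘ π) = _
    rw [hY]
    congr 1
    exact Equiv.prod_comp π fun i => (Jᴴ * N) (v i) (x i)
  · rw [hSL, Matrix.conjTranspose_mul, ← Matrix.mul_assoc, hYA,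
      Matrix.conjTranspose_rectTensorPow, ← Matrix.rectTensorPow_mul, Matrix.conjTranspose_mul,
      Matrix.conjTranspose_conjTranspose, hN, ← hss, ← Matrix.mul_assoc, Matrix.mul_assoc s s N,
      hsN, ← Matrix.mul_assoc, hsNs]

section ReducedState

variable {α β γ : Type*} [Fintype γ]

/-- The reduced state on the first two systems of the pure tripartite state with amplitudes `M`. -/
def reducedState (M : Matrix α (β × γ) ℂ) : Matrix (α × β) (α × β) ℂ :=
  (Matrix.of fun (p : α × β) e => M p.1 (p.2, e)) *
    (Matrix.of fun (p : α × β) e => M p.1 (p.2, e))ᴴ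

lemma posSemidef_reducedState [Finite α] [Finite β] (M : Matrix α (β × γ) ℂ) :
    (reducedState M).PosSemidef :=
  Matrix.posSemidef_self_mul_conjTranspose _

lemma ptrace_reducedState [Fintype β] (M : Matrix α (β × γ) ℂ) :
    ptrace (reducedState M) = M * Mᴴ := by
  ext x y
  simp [ptrace, reducedState, Matrix.mul_apply, Fintype.sum_prod_type]

lemma tensorPow_reducedState_apply [Fintype α] [Fintype β] {n : ℕ} (M : Matrix α (β × γ) ℂ)
    (v w : Fin n → α × β) :
    tensorPow (reducedState M) n v w = ∑ e : Fin n → γ,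
      (∏ i, M (v i).1 ((v i).2, e i)) * star (∏ i, M (w i).1 ((w i).2, e i)) := by
  classical
  simp only [tensorPow, reducedState, Matrix.of_apply, Matrix.mul_apply,
    Matrix.conjTranspose_apply, Finset.prod_univ_sum, Fintype.piFinset_univ,
    Finset.prod_mul_distrib, star_prod]

lemma continuous_reducedState : Continuous (reducedState : Matrix α (β × γ) ℂ → _) := by
  have h : Continuous fun M : Matrix α (β × γ) ℂ =>
      (Matrix.of fun (p : α × β) e => M p.1 (p.2, e) : Matrix (α × β) γ ℂ) :=
    continuous_matrix fun p e => continuous_id.matrix_elem _ _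
  exact h.matrix_mul h.matrix_conjTranspose

end ReducedState

theorem exists_measure_posSemidef_smul_sub {α β : Type*} [Fintype α] [DecidableEq α] [Fintype β]
    [DecidableEq β] [Nonempty β] {n : ℕ} {σhat : Matrix α α ℂ} (hσ : σhat.PosSemidef)
    {ρ : Matrix (Fin n → α × β) (Fin n → α × β) ℂ} (hρ : ρ.PosSemidef) (hperm : PermInvariant ρ)
    (hmarg : ptraceN ρ = tensorPow σhat n) :
    ∃ μ : Measure (Matrix (α × β) (α × β) ℂ), IsProbabilityMeasure μ ∧
      (∀ᵐ σ ∂μ, σ.PosSemidef ∧ ptrace σ = σhat) ∧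
      (∀ v w, Integrable (fun σ => tensorPow σ n v w) μ) ∧
      (((n + Fintype.card α ^ 2 * Fintype.card β ^ 2 - 1).choose n : ℂ) •
          (Matrix.of fun v w => ∫ σ, tensorPow σ n v w ∂μ) - ρ).PosSemidef := by
  let R := β × (α × β)
  obtain ⟨X, hX, hXX⟩ : ∃ X : Matrix (Fin n → α × β) (Fin n → α × β) ℂ,
      PermInvariant X ∧ X * Xᴴ = ρ := by
    open scoped MatrixOrder in
    refine ⟨CFC.sqrt ρ, hperm.sqrt hρ, ?_⟩
    rw [(CFC.sqrt_nonneg ρ).posSemidef.isHermitian.eq, CFC.sqrt_mul_sqrt_self ρ hρ.nonneg]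
  let Y : Matrix (Fin n → α) (Fin n → R) ℂ :=
    Matrix.of fun u r => X (fun i => (u i, (r i).1)) (fun i => (r i).2)
  have hYA : Y * Yᴴ = σhat.rectTensorPow n := by
    refine Eq.trans ?_ hmarg
    ext u u'
    simp only [ptraceN, ← hXX, Matrix.of_apply, Matrix.mul_apply, Matrix.conjTranspose_apply]
    rw [← Fintype.sum_prod_type', ← (Equiv.arrowProdEquivProdArrow _ _ _).sum_comp]
    rfl
  let b : β := Classical.arbitrary β
  let J : Matrix α R ℂ := (1 : Matrix R R ℂ).submatrix (fun a => (b, (a, b))) id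
  have hJ : J * Jᴴ = 1 := by
    ext x y
    simp [J, Matrix.mul_apply, Matrix.one_apply]
  obtain ⟨S, L, hS, hL, hSL, hSLL⟩ := exists_permInvariant_factor hσ hJ (Y := Y)
    (fun π v w => hX π (fun i => (v i, (w i).1)) fun i => (w i).2) hYA
  let : MeasurableSpace (Matrix.unitaryGroup R ℂ) := borel _
  have : BorelSpace (Matrix.unitaryGroup R ℂ) := ⟨rfl⟩
  let ν : Measure (Matrix.unitaryGroup R ℂ) := Measure.haarMeasure ⊤
  have : IsProbabilityMeasure ν := ⟨Measure.haarMeasure_self⟩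
  let f : Matrix.unitaryGroup R ℂ → Matrix (α × β) (α × β) ℂ :=
    fun U => reducedState (S * (U : Matrix R R ℂ)ᵀ)
  have : BorelSpace (Matrix (α × β) (α × β) ℂ) :=
    inferInstanceAs (BorelSpace (α × β → α × β → ℂ))
  have hf : Continuous f := continuous_reducedState.comp (by fun_prop)
  have hpow : ∀ v w, Continuous fun σ : Matrix (α × β) (α × β) ℂ => tensorPow σ n v w :=
    fun v w => continuous_finsetProd Finset.univ fun i _ =>
      continuous_id.matrix_elem (v i) (w i)
  have hpowm : ∀ v w, AEStronglyMeasurable (fun σ => tensorPow σ n v w) (ν.map f) :=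
    fun v w => (hpow v w).aestronglyMeasurable
  refine ⟨ν.map f, Measure.isProbabilityMeasure_map hf.aemeasurable, ?_, fun v w => ?_, ?_⟩
  · filter_upwards [ae_map_mem_range f (isCompact_range hf).isClosed.measurableSet ν]
    rintro _ ⟨U, rfl⟩
    refine ⟨posSemidef_reducedState _, ?_⟩
    rw [ptrace_reducedState, Matrix.conjTranspose_mul, Matrix.mul_assoc, ← Matrix.mul_assoc _ _ Sᴴ,
      ← hS]
    have hU : (U : Matrix R R ℂ)ᵀ * (U : Matrix R R ℂ)ᵀᴴ = 1 := by
      have := congrArg Matrix.transpose (Matrix.mem_unitaryGroup_iff'.1 U.2)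
      rw [Matrix.transpose_mul, Matrix.transpose_one] at this
      exact this
    rw [hU, Matrix.one_mul]
  · rw [integrable_map_measure (hpowm v w) hf.aemeasurable]
    exact ((hpow v w).comp hf).integrable_of_hasCompactSupport (HasCompactSupport.of_compactSpace _)
  · have key := posSemidef_choose_smul_twirl_sub ν S hL hSLL
    rw [hSL] at key
    have hcard : Fintype.card α * Fintype.card R =
        Fintype.card α ^ 2 * Fintype.card β ^ 2 := by
      simp only [R, Fintype.card_prod]
      ring
    rw [hcard, add_comm _ n] at key
    let x : (Fin n → α × β) → (Fin n → α × β) → (Fin n → R) × (Fin n → α) :=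
      fun e v => (fun i => ((v i).2, e i), fun i => (v i).1)
    convert Matrix.posSemidef_sum Finset.univ fun e _ => key.submatrix (x e) using 1
    ext v w
    simp only [Matrix.sub_apply, Matrix.smul_apply, Matrix.of_apply, Matrix.sum_apply,
      Matrix.submatrix_apply, Finset.sum_sub_distrib, ← Finset.smul_sum]
    congr 2
    · rw [integral_map hf.aemeasurable (hpowm v w)]
      simp only [f, tensorPow_reducedState_apply, twirl_tensorPowRep_apply]
      rw [integral_finsetSum]
      intro e _
      refine Continuous.integrable_of_hasCompactSupport ?_ (HasCompactSupport.of_compactSpace _)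
      fun_prop
    · rw [← hXX]
      rfl

end

/-- **Corollary 2.3 (de Finetti reduction for mixed states with fixed marginal).** -/
theorem deFinetti_mixed_fixed_marginal (n dA dB : ℕ) (hn : 0 < n) (hdA : 0 < dA) (hdB : 0 < dB)
    (σhat : Matrix (Fin dA) (Fin dA) ℂ) (hσ : σhat.PosSemidef)
    (ρ : Matrix (Fin n → Fin dA × Fin dB) (Fin n → Fin dA × Fin dB) ℂ)
    (hρ : ρ.PosSemidef) (hperm : PermInvariant ρ)
    (hmarg : ptraceN ρ = tensorPow σhat n) :
    ∃ μ : Measure (Matrix (Fin dA × Fin dB) (Fin dA × Fin dB) ℂ), IsProbabilityMeasure μ ∧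
      (∀ᵐ σ ∂μ, σ.PosSemidef ∧ ptrace σ = σhat) ∧
      (∀ v w, Integrable (fun σ => tensorPow σ n v w) μ) ∧
      (((n + dA ^ 2 * dB ^ 2 - 1).choose n : ℂ) •
          (Matrix.of fun v w => ∫ σ, tensorPow σ n v w ∂μ) - ρ).PosSemidef := by
  have : Nonempty (Fin dB) := ⟨⟨0, hdB⟩⟩
  simpa only [Fintype.card_fin] using exists_measure_posSemidef_smul_sub hσ hρ hperm hmarg

end
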